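/- Let L = [[A, B], [Bᵀ, D]] be a real symmetric block matrix, where A is a symmetric n×n matrix, D is a symmetric invertible m×m matrix, and B is n×m. Set H = A − B·D⁻¹·Bᵀ, and let X₀ be any symmetric matrix with H·X₀·H = H. Then the block matrix X = [[X₀, −X₀·B·D⁻¹], [−D⁻¹·Bᵀ·X₀, D⁻¹ + D⁻¹·Bᵀ·X₀·B·D⁻¹]] is symmetric and satisfies L·X·L = L; that is, X is a symmetric {1}-inverse of L. -/

import Mathlib

open Matrix

theorem schur_one_inverse
    {n m : Type} [Fintype n] [Fintype m] [DecidableEq n] [DecidableEq m]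
    (A : Matrix n n ℝ) (B : Matrix n m ℝ) (D : Matrix m m ℝ) (X0 : Matrix n n ℝ)
    (hA : A.IsSymm) (hD : D.IsSymm) (hDinv : IsUnit D)
    (hX0 : X0.IsSymm)
    (hX0H : (A - B * D⁻¹ * Bᵀ) * X0 * (A - B * D⁻¹ * Bᵀ) = A - B * D⁻¹ * Bᵀ) :
    (Matrix.fromBlocks X0 (-(X0 * B * D⁻¹)) (-(D⁻¹ * Bᵀ * X0))
        (D⁻¹ + D⁻¹ * Bᵀ * X0 * B * D⁻¹)).IsSymm ∧
      Matrix.fromBlocks A B Bᵀ D *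
          Matrix.fromBlocks X0 (-(X0 * B * D⁻¹)) (-(D⁻¹ * Bᵀ * X0))
            (D⁻¹ + D⁻¹ * Bᵀ * X0 * B * D⁻¹) *
          Matrix.fromBlocks A B Bᵀ D =
        Matrix.fromBlocks A B Bᵀ D := by
  have hu : IsUnit D.det := (Matrix.isUnit_iff_isUnit_det D).1 hDinv
  have hDt : (D⁻¹)ᵀ = D⁻¹ := by rw [Matrix.transpose_nonsing_inv, hD.eq]
  have h1 : D * D⁻¹ = 1 := Matrix.mul_nonsing_inv D hu
  have h2 : D⁻¹ * D = 1 := Matrix.nonsing_inv_mul D hu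
  refine ⟨?_, ?_⟩
  · unfold Matrix.IsSymm
    rw [Matrix.fromBlocks_transpose]
    simp only [Matrix.transpose_neg, Matrix.transpose_add, Matrix.transpose_mul, hDt, hX0.eq,
      Matrix.transpose_transpose, Matrix.mul_assoc]
  · obtain ⟨H, hH⟩ : ∃ H, H = A - B * D⁻¹ * Bᵀ := ⟨_, rfl⟩
    rw [← hH] at hX0H
    have hA' : A = H + B * D⁻¹ * Bᵀ := by rw [hH]; abel
    have e1 : Matrix.fromBlocks A B Bᵀ D *
          Matrix.fromBlocks X0 (-(X0 * B * D⁻¹)) (-(D⁻¹ * Bᵀ * X0))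
            (D⁻¹ + D⁻¹ * Bᵀ * X0 * B * D⁻¹) =
        Matrix.fromBlocks (H * X0) (-(H * X0 * B * D⁻¹) + B * D⁻¹) 0 1 := by
      have h1' : ∀ {k : Type} (Y : Matrix m k ℝ), D * (D⁻¹ * Y) = Y := fun Y => by
        rw [← Matrix.mul_assoc, h1, Matrix.one_mul]
      rw [Matrix.fromBlocks_multiply, hA']
      congr 1 <;>
        simp only [Matrix.mul_add, Matrix.add_mul, Matrix.mul_neg, Matrix.mul_assoc, h1, h1'] <;>
        abel
    rw [e1, Matrix.fromBlocks_multiply]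
    have e2 : H * X0 * A + (-(H * X0 * B * D⁻¹) + B * D⁻¹) * Bᵀ = A := by
      have : H * X0 * A + (-(H * X0 * B * D⁻¹) + B * D⁻¹) * Bᵀ
          = H * X0 * H + B * D⁻¹ * Bᵀ := by
        rw [hA']
        simp only [Matrix.mul_add, Matrix.add_mul, Matrix.neg_mul, Matrix.mul_assoc]
        abel
      rw [this, hX0H, ← hA']
    have e3 : H * X0 * B + (-(H * X0 * B * D⁻¹) + B * D⁻¹) * D = B := by
      simp only [Matrix.add_mul, Matrix.neg_mul, Matrix.mul_assoc, h2, Matrix.mul_one]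
      abel
    rw [e2, e3]
    simp
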